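/- Let d be an even positive integer, let n, a be positive integers with 2n = d·a, and let x ∈ SO_{2n+1}(ℂ) = {g ∈ M_{2n+1}(ℂ) : gᵀ g = 1, det g = 1} satisfy x^d = 1. Then the ℂ-dimension of {Y ∈ M_{2n+1}(ℂ) : Yᵀ = −Y and xY = Yx} (the centralizer of x in 𝔰𝔬_{2n+1}(ℂ)) is at least (d/2)·a², with equality if and only if the characteristic polynomial of x equals (T^d − 1)^a·(T − 1) when a is even, and equals (T^d − 1)^a·(T + 1) when a is odd; i.e. every d-th root of unity is an eigenvalue of multiplicity a except that one of ±1 (the one compatible with det x = 1) has multiplicity a + 1. -/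

import Mathlib

open Polynomial
open scoped Matrix

/-- The centralizer of `x` in the orthogonal Lie algebra `𝔰𝔬_N(ℂ) = {Y : Yᵀ = −Y}`:
the subspace of antisymmetric matrices commuting with `x`. -/
noncomputable def soCentralizer {N : Type*} [Fintype N] [DecidableEq N]
    (x : Matrix N N ℂ) : Submodule ℂ (Matrix N N ℂ) where
  carrier := {Y | Yᵀ = -Y ∧ x * Y = Y * x}
  zero_mem' := ⟨by simp, by simp⟩
  add_mem' := by
    intro Y Z hY hZ
    obtain ⟨h1, h2⟩ := hY
    obtain ⟨g1, g2⟩ := hZ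
    constructor
    · rw [Matrix.transpose_add, h1, g1, neg_add]
    · rw [Matrix.mul_add, Matrix.add_mul, h2, g2]
  smul_mem' := by
    intro c Y hY
    obtain ⟨h1, h2⟩ := hY
    constructor
    · rw [Matrix.transpose_smul, h1, smul_neg]
    · rw [Matrix.mul_smul, Matrix.smul_mul, h2]

theorem Module.End.exists_eigenbasis_of_pow_eq_one {V : Type*} [AddCommGroup V] [Module ℂ V]
    [FiniteDimensional ℂ V] {d : ℕ} (hd : 0 < d) (f : Module.End ℂ V) (hf : f ^ d = 1) :
    ∃ (s : Set V) (b : Module.Basis s ℂ V) (D : s → ℂ), ∀ i, f (b i) = D i • b i := by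
  have hss : f.IsSemisimple := by
    apply Module.End.isSemisimple_of_squarefree_aeval_eq_zero (p := (X : ℂ[X]) ^ d - 1)
    · refine Separable.squarefree ?_
      exact X_pow_sub_one_separable_iff.2 (by exact_mod_cast hd.ne')
    · simp [hf]
  have htop : ⊤ ≤ Submodule.span ℂ {v : V | ∃ μ : ℂ, f v = μ • v} := by
    rw [← hss.iSup_eigenspace_eq_top, iSup_le_iff]
    exact fun μ v hv ↦ Submodule.subset_span ⟨μ, Module.End.mem_eigenspace_iff.1 hv⟩
  have h (i) := Module.Basis.ofSpan_subset htop (Set.mem_range_self i)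
  choose D hD using h
  exact ⟨_, Module.Basis.ofSpan htop, D, hD⟩

theorem Matrix.exists_roots_charpoly_of_pow_eq_one {N : Type*} [Fintype N] [DecidableEq N]
    {d : ℕ} (hd : 0 < d) (x : Matrix N N ℂ) (hx : x ^ d = 1) :
    ∃ (s : Set (N → ℂ)) (_ : Fintype s) (D : s → ℂ), (∀ i, D i ^ d = 1) ∧
      x.charpoly.roots = Finset.univ.val.map D ∧ ∀ k, (x ^ k).trace = ∑ i, D i ^ k := by
  classical
  have hf : (Matrix.toLin' x) ^ d = 1 := by
    rw [← Matrix.toLin'_pow, hx, Matrix.toLin'_one]; rfl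
  obtain ⟨s, b, D, hb⟩ := Module.End.exists_eigenbasis_of_pow_eq_one hd _ hf
  let _ : Fintype s := FiniteDimensional.fintypeBasisIndex b
  have hpow (k : ℕ) (i) : (Matrix.toLin' x ^ k) (b i) = D i ^ k • b i := by
    induction k with
    | zero => simp
    | succ k ih => rw [pow_succ, Module.End.mul_apply, hb, map_smul, ih, smul_smul, ← pow_succ']
  have hmat (k : ℕ) : LinearMap.toMatrix b b (Matrix.toLin' x ^ k) =
      Matrix.diagonal fun i ↦ D i ^ k := by
    ext i j
    rw [LinearMap.toMatrix_apply, hpow, map_smul, b.repr_self, Matrix.diagonal_apply]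
    simp only [Finsupp.smul_apply, Finsupp.single_apply, smul_eq_mul, eq_comm (a := j)]
    split_ifs with h <;> simp [h]
  refine ⟨s, inferInstance, D, fun i ↦ ?_, ?_, fun k ↦ ?_⟩
  · have h := hpow d i
    rw [hf, Module.End.one_apply] at h
    exact smul_left_injective ℂ (b.ne_zero i) (by simpa using h.symm)
  · rw [← Matrix.charpoly_toLin', ← LinearMap.charpoly_toMatrix _ b]
    have := hmat 1
    simp only [pow_one] at this
    rw [this, Matrix.charpoly_diagonal, ← roots_multiset_prod_X_sub_C (Finset.univ.val.map D),
      Multiset.map_map]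
    rfl
  · rw [← Matrix.trace_toLin'_eq, Matrix.toLin'_pow, LinearMap.trace_eq_matrix_trace ℂ b, hmat,
      Matrix.trace_diagonal]

theorem Matrix.trace_eq_sum_apply_single {R N : Type*} [CommRing R] [Fintype N] [DecidableEq N]
    (f : Matrix N N R →ₗ[R] Matrix N N R) :
    LinearMap.trace R _ f = ∑ i, ∑ j, f (Matrix.single i j 1) i j := by
  rw [LinearMap.trace_eq_matrix_trace R (Matrix.stdBasis R N N), Matrix.trace,
    Fintype.sum_prod_type]
  refine Finset.sum_congr rfl fun i _ ↦ Finset.sum_congr rfl fun j _ ↦ ?_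
  rw [Matrix.diag_apply, LinearMap.toMatrix_apply, Matrix.stdBasis_eq_single]
  rfl

theorem sum_range_pow_of_pow_eq_one {K : Type*} [Field K] [DecidableEq K] {d : ℕ} {z : K}
    (hz : z ^ d = 1) :
    ∑ k ∈ Finset.range d, z ^ k = if z = 1 then (d : K) else 0 := by
  split_ifs with h
  · simp [h]
  · rw [geom_sum_eq h, hz, sub_self, zero_div]

/-- The unnormalised sum over powers `x ^ k`, `k < d`, of conjugation applied to `Y - Yᵀ`. -/
noncomputable def soAverage {N : Type*} [Fintype N] [DecidableEq N] (d : ℕ) (x : Matrix N N ℂ) :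
    Matrix N N ℂ →ₗ[ℂ] Matrix N N ℂ where
  toFun Y := ∑ k ∈ Finset.range d, x ^ k * (Y - Yᵀ) * (x ^ k)ᵀ
  map_add' Y Z := by
    rw [← Finset.sum_add_distrib]
    refine Finset.sum_congr rfl fun k _ ↦ ?_
    rw [Matrix.transpose_add, ← add_mul, ← mul_add]
    congr 2
    abel
  map_smul' c Y := by
    simp only [Matrix.transpose_smul, ← smul_sub, Matrix.mul_smul, Matrix.smul_mul,
      Finset.smul_sum, RingHom.id_apply]

theorem soAverage_apply {N : Type*} [Fintype N] [DecidableEq N] (d : ℕ) (x Y : Matrix N N ℂ) :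
    soAverage d x Y = ∑ k ∈ Finset.range d, x ^ k * (Y - Yᵀ) * (x ^ k)ᵀ := rfl

theorem trace_soAverage {N : Type*} [Fintype N] [DecidableEq N] (d : ℕ) (x : Matrix N N ℂ) :
    LinearMap.trace ℂ _ (soAverage d x) =
      ∑ k ∈ Finset.range d, ((x ^ k).trace * ((x ^ k)ᵀ).trace - (x ^ (2 * k)).trace) := by
  rw [Matrix.trace_eq_sum_apply_single]
  simp only [soAverage_apply, Matrix.sum_apply]
  have hterm (i j : N) (A : Matrix N N ℂ) :
      (A * (Matrix.single i j 1 - (Matrix.single i j 1)ᵀ) * Aᵀ : Matrix N N ℂ) i j =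
        A i i * A j j - A i j * A j i := by
    simp only [Matrix.mul_sub, Matrix.transpose_single, Matrix.sub_apply,
      Matrix.mul_apply, Matrix.single_apply, Matrix.transpose_apply]
    simp [Finset.sum_ite_eq, ite_and, sub_mul, Finset.sum_sub_distrib]
  simp only [hterm]
  simp_rw [Finset.sum_comm (s := Finset.univ) (t := Finset.range d)]
  refine Finset.sum_congr rfl fun k _ ↦ ?_
  rw [Matrix.trace_transpose, two_mul, pow_add]
  simp only [Finset.sum_sub_distrib, Matrix.trace, Matrix.diag_apply, Matrix.mul_apply,
    Finset.sum_mul_sum]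

theorem isProj_soAverage {N : Type*} [Fintype N] [DecidableEq N] {d : ℕ} (hd : 0 < d)
    (x : Matrix N N ℂ) (horth : xᵀ * x = 1) (hx : x ^ d = 1) :
    LinearMap.IsProj (soCentralizer x) ((2 * d : ℂ)⁻¹ • soAverage d x) := by
  have hd' : (d : ℂ) ≠ 0 := by exact_mod_cast hd.ne'
  have horth' : x * xᵀ = 1 := mul_eq_one_comm.1 horth
  refine ⟨fun Y ↦ Submodule.smul_mem _ _ ⟨?_, ?_⟩, fun Y hY ↦ ?_⟩
  · simp only [soAverage_apply, Matrix.transpose_sum, ← Finset.sum_neg_distrib]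
    refine Finset.sum_congr rfl fun k _ ↦ ?_
    simp only [Matrix.transpose_mul, Matrix.transpose_transpose, Matrix.transpose_sub]
    noncomm_ring
  · have hconj : x * soAverage d x Y * xᵀ = soAverage d x Y := by
      have h (k : ℕ) : x * (x ^ k * (Y - Yᵀ) * (x ^ k)ᵀ) * xᵀ =
          x ^ (k + 1) * (Y - Yᵀ) * (x ^ (k + 1))ᵀ := by
        rw [pow_succ', Matrix.transpose_mul]
        simp only [mul_assoc]
      rw [soAverage_apply, Finset.mul_sum, Finset.sum_mul]
      simp only [h]
      have h1 := Finset.sum_range_succ (fun k ↦ x ^ k * (Y - Yᵀ) * (x ^ k)ᵀ) d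
      rw [Finset.sum_range_succ'] at h1
      simpa [hx] using h1
    calc x * soAverage d x Y = x * soAverage d x Y * xᵀ * x := by
          rw [mul_assoc _ xᵀ, horth, mul_one]
      _ = soAverage d x Y * x := by rw [hconj]
  · obtain ⟨h1, h2⟩ := hY
    have h (k : ℕ) : x ^ k * (Y - Yᵀ) * (x ^ k)ᵀ = (2 : ℂ) • Y := by
      have hc : x ^ k * Y = Y * x ^ k := (Commute.pow_left h2 k)
      have ho : x ^ k * (x ^ k)ᵀ = 1 := by
        rw [Matrix.transpose_pow, ← (show Commute x xᵀ from horth'.trans horth.symm).mul_pow,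
          horth', one_pow]
      rw [h1, sub_neg_eq_add, ← two_smul ℂ, Matrix.mul_smul, Matrix.smul_mul, hc, mul_assoc, ho,
        mul_one]
    rw [LinearMap.smul_apply, soAverage_apply]
    simp only [h, Finset.sum_const, Finset.card_range]
    rw [← Nat.cast_smul_eq_nsmul ℂ, smul_smul, smul_smul]
    convert one_smul ℂ Y
    field_simp

open Classical in
/-- Dimension of the centralizer in terms of the multiplicities of the eigenvalues. -/
theorem two_mul_finrank_soCentralizer {N : Type*} [Fintype N] [DecidableEq N] {d : ℕ}
    (hd : 0 < d) (x : Matrix N N ℂ) (horth : xᵀ * x = 1) (hx : x ^ d = 1) :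
    2 * (Module.finrank ℂ (soCentralizer x) : ℤ) =
      ∑ z ∈ nthRootsFinset d (1 : ℂ), ((x.charpoly.roots.count z : ℤ) ^ 2 -
        if z ^ 2 = 1 then (x.charpoly.roots.count z : ℤ) else 0) := by
  have hd' : (d : ℂ) ≠ 0 := by exact_mod_cast hd.ne'
  obtain ⟨s, _, D, hD, hroots, htr⟩ := Matrix.exists_roots_charpoly_of_pow_eq_one hd x hx
  have hD0 (i) : D i ≠ 0 := fun h ↦ by simpa [h, hd.ne'] using hD i
  have hfin : (Module.finrank ℂ (soCentralizer x) : ℂ) = (2 * d : ℂ)⁻¹ *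
      ∑ k ∈ Finset.range d, ((x ^ k).trace * ((x ^ k)ᵀ).trace - (x ^ (2 * k)).trace) := by
    rw [← (isProj_soAverage hd x horth hx).trace, map_smul, trace_soAverage, smul_eq_mul]
  have htrT (k : ℕ) : ((x ^ k)ᵀ).trace = ∑ i, ((D i)⁻¹) ^ k := by
    have hxT : xᵀ = x ^ (d - 1) := by
      calc xᵀ = xᵀ * x ^ (d - 1 + 1) := by rw [Nat.sub_add_cancel hd, hx, mul_one]
        _ = x ^ (d - 1) := by rw [pow_succ', ← mul_assoc, horth, one_mul]
    rw [Matrix.transpose_pow, hxT, ← pow_mul, htr]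
    refine Finset.sum_congr rfl fun i _ ↦ ?_
    rw [pow_mul]
    congr 1
    exact eq_inv_of_mul_eq_one_left (by rw [← pow_succ, Nat.sub_add_cancel hd, hD])
  have hcount (z : ℂ) : (x.charpoly.roots.count z) = ∑ i, if D i = z then 1 else 0 := by
    rw [hroots, Multiset.count_map, Finset.sum_boole]
    simp [eq_comm, Finset.card_def]
  have hsum (g : ℂ → ℂ) : ∑ z ∈ nthRootsFinset d (1 : ℂ), (x.charpoly.roots.count z : ℂ) * g z =
      ∑ i, g (D i) := by
    simp only [hcount, Nat.cast_sum, Finset.sum_mul]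
    rw [Finset.sum_comm]
    refine Finset.sum_congr rfl fun i _ ↦ ?_
    simp [mem_nthRootsFinset hd, hD]
  have h1 : ∑ k ∈ Finset.range d, (x ^ k).trace * ((x ^ k)ᵀ).trace =
      d * ∑ i, (x.charpoly.roots.count (D i) : ℂ) := by
    simp only [htr, htrT, Finset.sum_mul_sum, ← mul_pow]
    rw [Finset.sum_comm, Finset.mul_sum]
    refine Finset.sum_congr rfl fun i _ ↦ ?_
    rw [Finset.sum_comm, hcount, Nat.cast_sum, Finset.mul_sum]
    refine Finset.sum_congr rfl fun j _ ↦ ?_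
    rw [sum_range_pow_of_pow_eq_one (by rw [mul_pow, inv_pow, hD, hD]; simp)]
    simp [mul_inv_eq_one₀ (hD0 j), eq_comm]
  have h2 : ∑ k ∈ Finset.range d, (x ^ (2 * k)).trace =
      d * ∑ i, if D i ^ 2 = 1 then (1 : ℂ) else 0 := by
    simp only [htr]
    rw [Finset.sum_comm, Finset.mul_sum]
    refine Finset.sum_congr rfl fun i _ ↦ ?_
    simp only [pow_mul]
    rw [sum_range_pow_of_pow_eq_one (by rw [pow_right_comm, hD, one_pow])]
    simp
  rw [Finset.sum_sub_distrib, h1, h2, ← hsum (fun z ↦ (x.charpoly.roots.count z : ℂ)),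
    ← hsum (fun z ↦ if z ^ 2 = 1 then (1 : ℂ) else 0)] at hfin
  have hfin' : 2 * (Module.finrank ℂ (soCentralizer x) : ℂ) =
      ∑ z ∈ nthRootsFinset d (1 : ℂ), ((x.charpoly.roots.count z : ℂ) ^ 2 -
        if z ^ 2 = 1 then (x.charpoly.roots.count z : ℂ) else 0) := by
    rw [hfin, Finset.sum_sub_distrib, ← mul_sub]
    simp only [mul_ite, mul_one, mul_zero, ← sq]
    field_simp
  exact_mod_cast hfin'

theorem Matrix.charpoly_eq_prod_nthRootsFinset {N : Type*} [Fintype N] [DecidableEq N] {d : ℕ}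
    (hd : 0 < d) (x : Matrix N N ℂ) (hx : x ^ d = 1) :
    x.charpoly = ∏ z ∈ nthRootsFinset d (1 : ℂ), (X - C z) ^ x.charpoly.roots.count z := by
  obtain ⟨s, _, D, hD, hroots, -⟩ := Matrix.exists_roots_charpoly_of_pow_eq_one hd x hx
  have hmem : ∀ z ∈ x.charpoly.roots, z ∈ nthRootsFinset d (1 : ℂ) := by
    intro z hz
    rw [hroots] at hz
    obtain ⟨i, -, rfl⟩ := Multiset.mem_map.1 hz
    exact (mem_nthRootsFinset hd _).2 (hD i)
  conv_lhs => rw [(IsAlgClosed.splits x.charpoly).eq_prod_roots_of_monic x.charpoly_monic]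
  rw [Finset.prod_multiset_map_count]
  exact Finset.prod_subset (fun z hz ↦ hmem z (Multiset.mem_toFinset.1 hz)) (by simp_all)

theorem sum_count_roots_charpoly {N : Type*} [Fintype N] [DecidableEq N] {d : ℕ}
    (hd : 0 < d) (x : Matrix N N ℂ) (hx : x ^ d = 1) :
    ∑ z ∈ nthRootsFinset d (1 : ℂ), x.charpoly.roots.count z = Fintype.card N := by
  have h := congrArg natDegree (x.charpoly_eq_prod_nthRootsFinset hd hx)
  rw [Matrix.charpoly_natDegree_eq_dim,
    natDegree_prod _ _ fun z _ ↦ pow_ne_zero _ (X_sub_C_ne_zero z)] at h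
  simpa using h.symm

theorem X_pow_sub_one_eq_prod_nthRootsFinset {d : ℕ} (hd : 0 < d) :
    (X : ℂ[X]) ^ d - 1 = ∏ z ∈ nthRootsFinset d (1 : ℂ), (X - C z) :=
  X_pow_sub_one_eq_prod hd (Complex.isPrimitiveRoot_exp d hd.ne')

open Classical in
theorem Matrix.charpoly_eq_pow_mul_X_sub_C_iff {N : Type*} [Fintype N] [DecidableEq N] {d : ℕ}
    (hd : 0 < d) (x : Matrix N N ℂ) (hx : x ^ d = 1) (a : ℕ) {w : ℂ} (hw : w ^ d = 1) :
    x.charpoly = ((X : ℂ[X]) ^ d - 1) ^ a * (X - C w) ↔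
      ∀ z ∈ nthRootsFinset d (1 : ℂ), x.charpoly.roots.count z = a + if z = w then 1 else 0 := by
  rw [X_pow_sub_one_eq_prod_nthRootsFinset hd]
  constructor
  · intro h z hz
    have hne : (∏ z ∈ nthRootsFinset d (1 : ℂ), (X - C z)) ^ a * (X - C w) ≠ 0 := by
      rw [← h]
      exact x.charpoly_monic.ne_zero
    rw [h, roots_mul hne, roots_pow, roots_prod_X_sub_C, roots_X_sub_C, Multiset.count_add,
      Multiset.count_nsmul, Multiset.count_singleton,
      Multiset.count_eq_one_of_mem (Finset.nodup _) hz, mul_one]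
  · intro h
    rw [x.charpoly_eq_prod_nthRootsFinset hd hx, Finset.prod_congr rfl fun z hz ↦ by rw [h z hz]]
    simp only [pow_add, Finset.prod_mul_distrib, Finset.prod_pow, pow_ite, pow_one, pow_zero]
    rw [Finset.prod_ite_eq', if_pos ((mem_nthRootsFinset hd _).2 hw)]

open Classical in
theorem sum_sq_sub_ite_nonneg {ι : Type*} (S : Finset ι) (e : ι → ℤ) (P : ι → Prop) :
    0 ≤ ∑ z ∈ S, (e z ^ 2 - if P z then e z else 0) := by
  refine Finset.sum_nonneg fun z _ ↦ ?_
  split_ifs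
  · nlinarith [Int.le_self_sq (e z)]
  · simpa using sq_nonneg (e z)

open Classical in
theorem sum_sq_sub_ite_eq_zero_iff {ι : Type*} (S : Finset ι) (e : ι → ℤ) (P : ι → Prop)
    (hsum : ∑ z ∈ S, e z = 1) :
    ∑ z ∈ S, (e z ^ 2 - if P z then e z else 0) = 0 ↔
      ∃ w ∈ S, P w ∧ ∀ z ∈ S, e z = if z = w then 1 else 0 := by
  constructor
  · intro h
    have hterm := (Finset.sum_eq_zero_iff_of_nonneg fun z _ ↦ by
      simpa using sum_sq_sub_ite_nonneg {z} e P).1 h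
    have hP : ∀ z ∈ S, e z = 0 ∨ P z ∧ e z = 1 := by
      intro z hz
      have hz' := hterm z hz
      split_ifs at hz' with hp
      · have : e z * (e z - 1) = 0 := by linarith
        rcases mul_eq_zero.1 this with h | h
        · exact .inl h
        · exact .inr ⟨hp, by linarith⟩
      · exact .inl (by simpa using hz')
    obtain ⟨w, hw, hw0⟩ : ∃ w ∈ S, e w ≠ 0 := Finset.exists_ne_zero_of_sum_ne_zero (by simp [hsum])
    obtain ⟨hPw, hew⟩ := (hP w hw).resolve_left hw0
    refine ⟨w, hw, hPw, fun z hz ↦ ?_⟩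
    split_ifs with hzw
    · rw [hzw, hew]
    · have h0 : ∑ z ∈ S.erase w, e z = 0 := by
        have := Finset.add_sum_erase S e hw
        linarith
      refine (Finset.sum_eq_zero_iff_of_nonneg fun y hy ↦ ?_).1 h0 z (Finset.mem_erase.2 ⟨hzw, hz⟩)
      rcases hP y (Finset.mem_of_mem_erase hy) with h | ⟨-, h⟩ <;> simp [h]
  · rintro ⟨w, hw, hPw, h⟩
    refine Finset.sum_eq_zero fun z hz ↦ ?_
    rw [h z hz]
    by_cases hzw : z = w
    · simp [hzw, hPw]
    · simp [hzw]

open Classical in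
theorem sum_nthRootsFinset_ite_sq_eq_one {d : ℕ} (hdeven : Even d) (hd : 0 < d) (c : ℤ) :
    ∑ z ∈ nthRootsFinset d (1 : ℂ), (if z ^ 2 = 1 then c else 0) = 2 * c := by
  have h : (nthRootsFinset d (1 : ℂ)).filter (fun z ↦ z ^ 2 = 1) = {1, -1} := by
    ext z
    simp only [Finset.mem_filter, mem_nthRootsFinset hd, Finset.mem_insert, Finset.mem_singleton,
      sq_eq_one_iff]
    constructor
    · exact fun h ↦ h.2
    · rintro (rfl | rfl)
      · simp
      · simp [hdeven.neg_one_pow]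
  rw [← Finset.sum_filter, h, Finset.sum_pair (by norm_num)]
  ring

open Classical in
/-- let `d` be even, `2n = d·a`, and let `x ∈ SO_{2n+1}(ℂ)` (i.e. `xᵀ x = 1`,
`det x = 1`) satisfy `x^d = 1`.  Then the centralizer of `x` in `𝔰𝔬_{2n+1}(ℂ)` has
dimension at least `(d/2)·a²`, with equality iff the characteristic polynomial of `x` is
`(T^d − 1)^a (T − 1)` when `a` is even and `(T^d − 1)^a (T + 1)` when `a` is odd. -/
theorem so_odd_centralizer_dim_ge {n d a : ℕ} (hdeven : Even d) (hdpos : 0 < d)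
    (hnpos : 0 < n) (hapos : 0 < a) (hn : 2 * n = d * a)
    (x : Matrix (Fin (2 * n + 1)) (Fin (2 * n + 1)) ℂ)
    (horth : xᵀ * x = 1) (hdet : x.det = 1) (hx : x ^ d = 1) :
    (d / 2) * a ^ 2 ≤ Module.finrank ℂ (soCentralizer x) ∧
    (Module.finrank ℂ (soCentralizer x) = (d / 2) * a ^ 2 ↔
      x.charpoly = if Even a then ((X : ℂ[X]) ^ d - 1) ^ a * (X - 1)
        else ((X : ℂ[X]) ^ d - 1) ^ a * (X + 1)) := by
  have hcard : (nthRootsFinset d (1 : ℂ)).card = d :=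
    (Complex.isPrimitiveRoot_exp d hdpos.ne').card_nthRootsFinset
  set S := nthRootsFinset d (1 : ℂ)
  set e : ℂ → ℤ := fun z ↦ (x.charpoly.roots.count z : ℤ) - a with he
  have hsum : ∑ z ∈ S, e z = 1 := by
    have h : ∑ z ∈ S, (x.charpoly.roots.count z : ℤ) = d * a + 1 := by
      have h := sum_count_roots_charpoly hdpos x hx
      rw [Fintype.card_fin] at h
      have hn' : (2 * n : ℤ) = d * a := by exact_mod_cast hn
      rw [← hn']
      exact_mod_cast h
    rw [Finset.sum_sub_distrib, h, Finset.sum_const, hcard, nsmul_eq_mul]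
    ring
  have hdim : 2 * (Module.finrank ℂ (soCentralizer x) : ℤ) =
      d * a ^ 2 + ∑ z ∈ S, (e z ^ 2 - if z ^ 2 = 1 then e z else 0) := by
    have hterm (z : ℂ) : ((x.charpoly.roots.count z : ℤ) ^ 2 -
        if z ^ 2 = 1 then (x.charpoly.roots.count z : ℤ) else 0) =
        (a : ℤ) ^ 2 + 2 * a * e z - (if z ^ 2 = 1 then (a : ℤ) else 0) +
          (e z ^ 2 - if z ^ 2 = 1 then e z else 0) := by
      simp only [he]
      split_ifs <;> ring
    rw [two_mul_finrank_soCentralizer hdpos x horth hx, Finset.sum_congr rfl fun z _ ↦ hterm z,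
      Finset.sum_add_distrib, Finset.sum_sub_distrib, Finset.sum_add_distrib, ← Finset.mul_sum,
      hsum, sum_nthRootsFinset_ite_sq_eq_one hdeven hdpos, Finset.sum_const, hcard, nsmul_eq_mul]
    ring
  have hhalf : ((d / 2 * a ^ 2 : ℕ) : ℤ) * 2 = d * a ^ 2 := by
    have : d / 2 * 2 = d := Nat.div_mul_cancel hdeven.two_dvd
    nth_rw 2 [← this]
    push_cast
    ring
  have hite : (if Even a then ((X : ℂ[X]) ^ d - 1) ^ a * (X - 1)
      else ((X : ℂ[X]) ^ d - 1) ^ a * (X + 1)) =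
      ((X : ℂ[X]) ^ d - 1) ^ a * (X - C ((-1) ^ a)) := by
    split_ifs with h
    · simp [h.neg_one_pow]
    · simp [(Nat.not_even_iff_odd.1 h).neg_one_pow]
  have hpow {w : ℂ} (hw : w ^ 2 = 1) : w ^ d = 1 := by
    obtain ⟨k, rfl⟩ := hdeven.two_dvd
    rw [pow_mul, hw, one_pow]
  have hcount (w z : ℂ) : (e z = if z = w then 1 else 0) ↔
      x.charpoly.roots.count z = a + if z = w then 1 else 0 := by
    simp only [he]
    split_ifs <;> omega
  refine ⟨?_, ?_⟩
  · have := sum_sq_sub_ite_nonneg S e fun z ↦ z ^ 2 = 1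
    zify at *
    linarith
  have hiff : Module.finrank ℂ (soCentralizer x) = d / 2 * a ^ 2 ↔
      ∑ z ∈ S, (e z ^ 2 - if z ^ 2 = 1 then e z else 0) = 0 := by
    omega
  rw [hiff, hite, sum_sq_sub_ite_eq_zero_iff S e _ hsum]
  simp only [hcount]
  constructor
  · rintro ⟨w, -, hw, h⟩
    have hchar := (x.charpoly_eq_pow_mul_X_sub_C_iff hdpos hx a (hpow hw)).2 h
    have hdetw : (-1) ^ a * w = 1 := by
      rw [Matrix.det_eq_sign_charpoly_coeff, hchar, coeff_zero_eq_eval_zero, Fintype.card_fin] at hdet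
      simpa [hdpos.ne', pow_succ, pow_mul] using hdet
    have hw' : w = (-1) ^ a := by
      rw [← mul_one ((-1 : ℂ) ^ a)]
      nth_rw 2 [← hdetw]
      rw [← mul_assoc, ← mul_pow]
      simp
    rwa [hw'] at hchar
  · intro h
    have hw : ((-1 : ℂ) ^ a) ^ 2 = 1 := by rw [pow_right_comm]; simp
    exact ⟨_, (mem_nthRootsFinset hdpos _).2 (hpow hw), hw,
      (x.charpoly_eq_pow_mul_X_sub_C_iff hdpos hx a (hpow hw)).1 h⟩
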